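/- arXiv:1606.02682 — 8 statements merged into one kernel-verified Lean document; each statement's English description precedes it below -/
import Mathlib

section
/- The principal score is a balancing score: the conditional expectation of the stratum indicator given the covariate equals its conditional expectation given the principal score alone. Precisely, letting π := E[1_{S} | σ(X)] (a version of the conditional expectation), one has E[1_{S} | σ(X)] = E[1_{S} | σ(π)] P-almost surely, where σ(π) is the σ-algebra generated by the random variable π. -/
open MeasureTheory ProbabilityTheory

/-- Conditioning on a sub-σ-algebra `m` agrees with conditioning on the σ-algebra generated by
the conditional expectation given `m`. -/
theorem condExp_ae_eq_condExp_comap_condExp {Ω : Type*} {m mΩ : MeasurableSpace Ω}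
    (μ : Measure Ω) [IsFiniteMeasure μ] (hm : m ≤ mΩ) (f : Ω → ℝ) :
    μ[f | m] =ᵐ[μ] μ[f | MeasurableSpace.comap (μ[f | m]) Real.measurableSpace] := by
  have hle : MeasurableSpace.comap (μ[f | m]) Real.measurableSpace ≤ m :=
    stronglyMeasurable_condExp.measurable.comap_le
  have hπ : StronglyMeasurable[MeasurableSpace.comap (μ[f | m]) Real.measurableSpace]
      (μ[f | m]) :=
    (comap_measurable (μ[f | m])).stronglyMeasurable
  have htower := condExp_condExp_of_le (μ := μ) (f := f) hle hm
  rwa [condExp_of_stronglyMeasurable (hle.trans hm) hπ integrable_condExp] at htower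

/-- The principal score `π := E[1_S | σ(X)]` is a balancing score:
`E[1_S | σ(X)] = E[1_S | σ(π)]` `P`-almost surely. -/
theorem principal_score_is_balancing_score
    {Ω 𝒳 : Type*} {mΩ : MeasurableSpace Ω} {m𝒳 : MeasurableSpace 𝒳}
    (P : Measure Ω) [IsProbabilityMeasure P]
    (X : Ω → 𝒳) (S : Ω → Bool)
    (hX : Measurable X) (hS : Measurable S) :
    P[(fun ω => if S ω then (1 : ℝ) else 0) | MeasurableSpace.comap X m𝒳]
      =ᵐ[P]
    P[(fun ω => if S ω then (1 : ℝ) else 0) |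
        MeasurableSpace.comap
          (P[(fun ω => if S ω then (1 : ℝ) else 0) | MeasurableSpace.comap X m𝒳])
          Real.measurableSpace] :=
  condExp_ae_eq_condExp_comap_condExp P hX.comap_le _
end

section
/- Principal Ignorability given the covariate implies Principal Ignorability given the principal score: if for an integrable random variable Y : Ω → ℝ one has E[1_{S} | σ(Y) ⊔ σ(X)] = E[1_{S} | σ(X)] P-almost surely, then also E[1_{S} | σ(Y) ⊔ σ(π)] = E[1_{S} | σ(π)] P-almost surely, where π := E[1_{S} | σ(X)] is the principal score. -/
open MeasureTheory ProbabilityTheory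

/-- If a version `g` of the conditional expectation of `f` given `n` is measurable with respect to
a smaller σ-algebra `m`, then `g` is also a version of the conditional expectation given `m`. -/
lemma condExp_ae_eq_of_condExp_ae_eq_of_le {Ω E : Type*} {m n m₀ : MeasurableSpace Ω}
    [NormedAddCommGroup E] [NormedSpace ℝ E] [CompleteSpace E]
    {μ : Measure Ω} [IsFiniteMeasure μ] {f g : Ω → E} (hmn : m ≤ n) (hn : n ≤ m₀)
    (hg : StronglyMeasurable[m] g) (hfg : μ[f | n] =ᵐ[μ] g) : μ[f | m] =ᵐ[μ] g :=
  calc μ[f | m] =ᵐ[μ] μ[μ[f | n] | m] := (condExp_condExp_of_le hmn hn).symm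
    _ =ᵐ[μ] μ[g | m] := condExp_congr_ae hfg
    _ = g := condExp_of_stronglyMeasurable (hmn.trans hn) hg (integrable_condExp.congr hfg)

/-- Principal Ignorability given the covariate `X` implies Principal Ignorability
given the principal score `π := E[1_S | σ(X)]`. -/
theorem principal_ignorability_given_score
    {Ω 𝒳 : Type*} {mΩ : MeasurableSpace Ω} {m𝒳 : MeasurableSpace 𝒳}
    (P : Measure Ω) [IsProbabilityMeasure P]
    (X : Ω → 𝒳) (S : Ω → Bool) (Y : Ω → ℝ)
    (hX : Measurable X) (hS : Measurable S) (hYm : Measurable Y)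
    (hY : Integrable Y P)
    (hPI :
      P[(fun ω => if S ω then (1 : ℝ) else 0) |
          MeasurableSpace.comap Y Real.measurableSpace ⊔ MeasurableSpace.comap X m𝒳]
        =ᵐ[P]
      P[(fun ω => if S ω then (1 : ℝ) else 0) | MeasurableSpace.comap X m𝒳]) :
    P[(fun ω => if S ω then (1 : ℝ) else 0) |
        MeasurableSpace.comap Y Real.measurableSpace ⊔
          MeasurableSpace.comap
            (P[(fun ω => if S ω then (1 : ℝ) else 0) | MeasurableSpace.comap X m𝒳])
            Real.measurableSpace]
      =ᵐ[P]
    P[(fun ω => if S ω then (1 : ℝ) else 0) |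
        MeasurableSpace.comap
          (P[(fun ω => if S ω then (1 : ℝ) else 0) | MeasurableSpace.comap X m𝒳])
          Real.measurableSpace] := by
  set π := P[(fun ω => if S ω then (1 : ℝ) else 0) | MeasurableSpace.comap X m𝒳] with hπ
  have hπX : MeasurableSpace.comap π Real.measurableSpace ≤ MeasurableSpace.comap X m𝒳 :=
    stronglyMeasurable_condExp.measurable.comap_le
  have hπm : StronglyMeasurable[MeasurableSpace.comap π Real.measurableSpace] π :=
    (comap_measurable π).stronglyMeasurable
  have hYπ := condExp_ae_eq_of_condExp_ae_eq_of_le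
    (sup_le_sup_left hπX (MeasurableSpace.comap Y Real.measurableSpace))
    (sup_le hYm.comap_le hX.comap_le) (hπm.mono le_sup_right) hPI
  have hππ := condExp_ae_eq_of_condExp_ae_eq_of_le hπX hX.comap_le hπm
    (Filter.EventuallyEq.of_eq hπ.symm)
  exact hYπ.trans hππ.symm
end

section
/- Stratum-mean identification under mean-independence: let S : Ω → 𝒮 be a measurable map into a countable measurable space, s ∈ 𝒮 with P(S = s) > 0, and Y : Ω → ℝ integrable. Set π_s := E[1_{S = s} | σ(X)]. If E[Y | σ(S) ⊔ σ(X)] = E[Y | σ(X)] P-almost surely, then E[Y · 1_{S = s}] = E[π_s · Y]; in particular P(S = s) = E[π_s] and E[Y | S = s] = E[π_s · Y] / P(S = s). -/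
open MeasureTheory ProbabilityTheory

/-- Conditional expectation is self-adjoint for the pairing of bounded and integrable functions. -/
theorem integral_mul_condExp_eq_integral_condExp_mul {Ω : Type*} {m mΩ : MeasurableSpace Ω}
    (hm : m ≤ mΩ) {μ : Measure Ω} [IsFiniteMeasure μ] {f g : Ω → ℝ} {R : ℝ}
    (hf : Integrable f μ) (hfR : ∀ᵐ ω ∂μ, |f ω| ≤ R) (hg : Integrable g μ) :
    ∫ ω, f ω * (μ[g | m]) ω ∂μ = ∫ ω, (μ[f | m]) ω * g ω ∂μ := by
  have hfg : Integrable (f * μ[g | m]) μ :=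
    integrable_condExp.bdd_mul hf.aestronglyMeasurable hfR
  have hgf : Integrable (μ[f | m] * g) μ :=
    hg.bdd_mul integrable_condExp.aestronglyMeasurable (ae_bdd_abs_condExp_of_ae_bdd_abs hfR)
  calc ∫ ω, f ω * (μ[g | m]) ω ∂μ
      = ∫ ω, (μ[f * μ[g | m] | m]) ω ∂μ := (integral_condExp hm).symm
    _ = ∫ ω, (μ[μ[f | m] * g | m]) ω ∂μ := integral_congr_ae <|
        (condExp_mul_of_stronglyMeasurable_right stronglyMeasurable_condExp hfg hf).trans
          (condExp_mul_of_stronglyMeasurable_left stronglyMeasurable_condExp hgf hg).symm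
    _ = ∫ ω, (μ[f | m]) ω * g ω ∂μ := integral_condExp hm

/-- Stratum-mean identification under mean-independence: with
`π_s := E[1_{S = s} | σ(X)]`, if `E[Y | σ(S) ⊔ σ(X)] = E[Y | σ(X)]` a.s., then
`E[Y · 1_{S = s}] = E[π_s · Y]`, `P(S = s) = E[π_s]`, and
`E[Y | S = s] = E[π_s · Y] / P(S = s)`. -/
theorem stratum_mean_identification
    {Ω 𝒳 𝒮 : Type*} {mΩ : MeasurableSpace Ω} {m𝒳 : MeasurableSpace 𝒳}
    {m𝒮 : MeasurableSpace 𝒮} [Countable 𝒮] [MeasurableSingletonClass 𝒮]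
    (P : Measure Ω) [IsProbabilityMeasure P]
    (X : Ω → 𝒳) (S : Ω → 𝒮) (Y : Ω → ℝ) (s : 𝒮)
    (hX : Measurable X) (hS : Measurable S) (hY : Integrable Y P)
    (hs : 0 < P {ω | S ω = s})
    (hMI : P[Y | MeasurableSpace.comap S m𝒮 ⊔ MeasurableSpace.comap X m𝒳]
        =ᵐ[P] P[Y | MeasurableSpace.comap X m𝒳]) :
    (∫ ω, Y ω * Set.indicator {ω' | S ω' = s} (fun _ => (1 : ℝ)) ω ∂P)
        = ∫ ω, (P[Set.indicator {ω' | S ω' = s} (fun _ => (1 : ℝ)) |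
            MeasurableSpace.comap X m𝒳]) ω * Y ω ∂P
      ∧ (P {ω | S ω = s}).toReal
        = ∫ ω, (P[Set.indicator {ω' | S ω' = s} (fun _ => (1 : ℝ)) |
            MeasurableSpace.comap X m𝒳]) ω ∂P
      ∧ (∫ ω, Y ω ∂(P[|{ω | S ω = s}]))
        = (∫ ω, (P[Set.indicator {ω' | S ω' = s} (fun _ => (1 : ℝ)) |
            MeasurableSpace.comap X m𝒳]) ω * Y ω ∂P) / (P {ω | S ω = s}).toReal := by
  set A : Set Ω := {ω | S ω = s}
  have hA₀ : MeasurableSet[MeasurableSpace.comap S m𝒮] A :=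
    ⟨{s}, measurableSet_singleton s, rfl⟩
  have hA : MeasurableSet A := hS.comap_le _ hA₀
  have hmul : ∀ g : Ω → ℝ, ∫ ω, g ω * A.indicator (fun _ => (1 : ℝ)) ω ∂P = ∫ ω in A, g ω ∂P := by
    intro g
    rw [← integral_indicator hA]
    congr with ω
    by_cases h : ω ∈ A <;> simp [h]
  have hbdd : ∀ᵐ ω ∂P, |A.indicator (fun _ => (1 : ℝ)) ω| ≤ 1 :=
    .of_forall fun ω => by by_cases h : ω ∈ A <;> simp [h]
  have hY_A : ∫ ω, Y ω * A.indicator (fun _ => (1 : ℝ)) ω ∂P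
      = ∫ ω, (P[A.indicator (fun _ => (1 : ℝ)) | MeasurableSpace.comap X m𝒳]) ω * Y ω ∂P := by
    rw [← integral_mul_condExp_eq_integral_condExp_mul hX.comap_le
      ((integrable_const 1).indicator hA) hbdd hY, hmul,
      ← setIntegral_condExp (sup_le hS.comap_le hX.comap_le) hY
        ((le_sup_left : _ ≤ MeasurableSpace.comap S m𝒮 ⊔ MeasurableSpace.comap X m𝒳) A hA₀),
      setIntegral_congr_ae hA (hMI.mono fun ω h _ => h), ← hmul]
    simp_rw [mul_comm]
  refine ⟨hY_A, ?_, ?_⟩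
  · rw [integral_condExp hX.comap_le, integral_indicator_const _ hA]
    simp [Measure.real]
  · rw [← hY_A, hmul, ProbabilityTheory.cond, integral_smul_measure, ENNReal.toReal_inv,
      smul_eq_mul, inv_mul_eq_div]
end

section
/- Identification of the principal causal effect on High Takers by the weighting method under Weak Principal Ignorability: assume randomization (Z independent of (X, S, Y0, Y1) with 0 < P(Z = true) < 1), P(S = true) > 0, P({Z = true} ∩ {S = true}) > 0, and Weak Principal Ignorability E[Y0 | σ(S) ⊔ σ(X)] = E[Y0 | σ(X)] P-a.s. Then, with π := E[1_{S} | σ(X)] and observed outcome Y := if Z then Y1 else Y0, one has E[Y | {Z = true} ∩ {S = true}] − E[π · Y | Z = false] / E[π | Z = false] = E[Y1 − Y0 | S = true]. -/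
open MeasureTheory ProbabilityTheory

/-- The integral against a conditioned measure is the average over the event. -/
theorem integral_cond_eq_inv_mul_setIntegral {Ω : Type*} {mΩ : MeasurableSpace Ω}
    (P : Measure Ω) (A : Set Ω) (f : Ω → ℝ) :
    ∫ ω, f ω ∂(P[|A]) = (P.real A)⁻¹ * ∫ ω in A, f ω ∂P := by
  rw [ProbabilityTheory.cond, integral_smul_measure, ENNReal.toReal_inv, smul_eq_mul,
    measureReal_def]

/-- Conditioning additionally on an event independent of `f` and `B` does not change the
conditional mean of `f` given `B`. -/
theorem integral_cond_inter_of_indep {Ω : Type*} {m₁ m₂ mΩ : MeasurableSpace Ω}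
    {P : Measure Ω} [IsProbabilityMeasure P] (hm₁ : m₁ ≤ mΩ) (hm₂ : m₂ ≤ mΩ)
    (hindep : Indep m₁ m₂ P) {f : Ω → ℝ} (hf : StronglyMeasurable[m₁] f)
    (hfi : Integrable f P) {A B : Set Ω} (hA : MeasurableSet[m₂] A)
    (hB : MeasurableSet[m₁] B) (hA0 : P A ≠ 0) :
    ∫ ω, f ω ∂(P[|A ∩ B]) = ∫ ω, f ω ∂(P[|B]) := by
  have hprod : P.real (A ∩ B) = P.real A * P.real B := by
    rw [Set.inter_comm, measureReal_def, (Indep_iff _ _ _).1 hindep B A hB hA,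
      ENNReal.toReal_mul, mul_comm]
    rfl
  have hset : ∫ ω in A ∩ B, f ω ∂P = P.real A * ∫ ω in B, f ω ∂P := by
    have hce := condExp_indep_eq hm₁ hm₂ (hf.indicator hB) hindep
    rw [← setIntegral_indicator (hm₁ _ hB),
      ← setIntegral_condExp hm₂ (hfi.indicator (hm₁ _ hB)) hA,
      setIntegral_congr_ae (hm₂ _ hA) (hce.mono fun ω h _ => h), setIntegral_const,
      integral_indicator (hm₁ _ hB), smul_eq_mul]
  have hA' : P.real A ≠ 0 := (measureReal_ne_zero_iff).2 hA0
  rw [integral_cond_eq_inv_mul_setIntegral, integral_cond_eq_inv_mul_setIntegral, hprod, hset]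
  field_simp

/-- Conditioning on an independent event does not change the mean. -/
theorem integral_cond_of_indep {Ω : Type*} {m₁ m₂ mΩ : MeasurableSpace Ω}
    {P : Measure Ω} [IsProbabilityMeasure P] (hm₁ : m₁ ≤ mΩ) (hm₂ : m₂ ≤ mΩ)
    (hindep : Indep m₁ m₂ P) {f : Ω → ℝ} (hf : StronglyMeasurable[m₁] f)
    (hfi : Integrable f P) {A : Set Ω} (hA : MeasurableSet[m₂] A) (hA0 : P A ≠ 0) :
    ∫ ω, f ω ∂(P[|A]) = ∫ ω, f ω ∂P := by
  simpa using integral_cond_inter_of_indep hm₁ hm₂ hindep hf hfi hA MeasurableSet.univ hA0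

/-- A bounded `m`-measurable weight only sees the conditional expectation given `m`. -/
theorem integral_mul_condExp_of_bound {Ω : Type*} {m mΩ : MeasurableSpace Ω}
    {P : Measure Ω} [IsFiniteMeasure P] (hm : m ≤ mΩ) {f g : Ω → ℝ}
    (hf : StronglyMeasurable[m] f) (hg : Integrable g P) (c : ℝ)
    (hc : ∀ᵐ ω ∂P, ‖f ω‖ ≤ c) :
    ∫ ω, f ω * (P[g | m]) ω ∂P = ∫ ω, f ω * g ω ∂P := by
  rw [← integral_condExp hm (f := fun ω => f ω * g ω)]
  exact integral_congr_ae (condExp_stronglyMeasurable_mul_of_bound hm hf hg c hc).symm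

/-- If enlarging `m` to `m'` does not change the conditional expectation of `g`, then a bounded
`m'`-measurable weight may be replaced by its conditional expectation given `m`. -/
theorem integral_condExp_mul_of_condExp_eq {Ω : Type*} {m m' mΩ : MeasurableSpace Ω}
    {P : Measure Ω} [IsFiniteMeasure P] (hm : m ≤ mΩ) (hm' : m' ≤ mΩ) {f g : Ω → ℝ}
    (hf : StronglyMeasurable[m'] f) (hg : Integrable g P) (c : ℝ)
    (hc : ∀ ω, |f ω| ≤ c) (h : P[g | m'] =ᵐ[P] P[g | m]) :
    ∫ ω, (P[f | m]) ω * g ω ∂P = ∫ ω, f ω * g ω ∂P := by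
  have hfi : Integrable f P :=
    .of_bound (hf.mono hm').aestronglyMeasurable c (.of_forall hc)
  have hfg : Integrable (f * P[g | m]) P :=
    integrable_condExp.bdd_mul (hf.mono hm').aestronglyMeasurable (.of_forall hc)
  calc ∫ ω, (P[f | m]) ω * g ω ∂P
      = ∫ ω, (P[f | m]) ω * (P[g | m]) ω ∂P :=
        (integral_mul_condExp_of_bound hm stronglyMeasurable_condExp hg c
          (ae_bdd_abs_condExp_of_ae_bdd_abs (.of_forall hc))).symm
    _ = ∫ ω, f ω * (P[g | m]) ω ∂P := by
        rw [← integral_condExp hm (f := fun ω => f ω * (P[g | m]) ω)]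
        exact integral_congr_ae
          (condExp_mul_of_stronglyMeasurable_right stronglyMeasurable_condExp hfg hfi).symm
    _ = ∫ ω, f ω * (P[g | m']) ω ∂P :=
        integral_congr_ae (h.mono fun ω hω => by simp only [hω])
    _ = ∫ ω, f ω * g ω ∂P := integral_mul_condExp_of_bound hm' hf hg c (.of_forall hc)

/-- Identification of the principal causal effect on High Takers by the weighting
method under Weak Principal Ignorability:
`E[Y | Z = 1, S = 1] − E[π·Y | Z = 0] / E[π | Z = 0] = E[Y1 − Y0 | S = 1]`. -/
theorem weighting_identification_weak_PI
    {Ω 𝒳 : Type*} {mΩ : MeasurableSpace Ω} {m𝒳 : MeasurableSpace 𝒳}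
    (P : Measure Ω) [IsProbabilityMeasure P]
    (X : Ω → 𝒳) (S Z : Ω → Bool) (Y0 Y1 : Ω → ℝ)
    (hX : Measurable X) (hS : Measurable S) (hZ : Measurable Z)
    (hY0m : Measurable Y0) (hY1m : Measurable Y1)
    (hY0 : Integrable Y0 P) (hY1 : Integrable Y1 P)
    (hindep : IndepFun Z (fun ω => (X ω, S ω, Y0 ω, Y1 ω)) P)
    (hZpos : 0 < P {ω | Z ω = true}) (hZlt : P {ω | Z ω = true} < 1)
    (hSpos : 0 < P {ω | S ω = true})
    (hZSpos : 0 < P ({ω | Z ω = true} ∩ {ω | S ω = true}))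
    (hWPI : P[Y0 | MeasurableSpace.comap S inferInstance ⊔ MeasurableSpace.comap X m𝒳]
        =ᵐ[P] P[Y0 | MeasurableSpace.comap X m𝒳]) :
    (∫ ω, (if Z ω then Y1 ω else Y0 ω) ∂(P[|{ω | Z ω = true} ∩ {ω | S ω = true}]))
      - (∫ ω, (P[(fun ω' => if S ω' then (1 : ℝ) else 0) | MeasurableSpace.comap X m𝒳]) ω
            * (if Z ω then Y1 ω else Y0 ω) ∂(P[|{ω | Z ω = false}]))
        / (∫ ω, (P[(fun ω' => if S ω' then (1 : ℝ) else 0) | MeasurableSpace.comap X m𝒳]) ω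
            ∂(P[|{ω | Z ω = false}]))
      = ∫ ω, (Y1 ω - Y0 ω) ∂(P[|{ω | S ω = true}]) := by
  set m := MeasurableSpace.comap X m𝒳
  set s : Ω → ℝ := fun ω' => if S ω' then (1 : ℝ) else 0 with hs
  set W : Ω → 𝒳 × Bool × ℝ × ℝ := fun ω => (X ω, S ω, Y0 ω, Y1 ω)
  set mW := MeasurableSpace.comap W inferInstance
  set m' := MeasurableSpace.comap S inferInstance ⊔ m
  have hWm : Measurable[mΩ] W := hX.prodMk (hS.prodMk (hY0m.prodMk hY1m))
  have hm : m ≤ mΩ := hX.comap_le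
  have hm' : m' ≤ mΩ := sup_le hS.comap_le hm
  have hmW_le : mW ≤ mΩ := hWm.comap_le
  have hZ_le := hZ.comap_le
  have hWW : Measurable[mW] W := comap_measurable W
  have hXW : Measurable[mW] X := measurable_fst.comp hWW
  have hSW : Measurable[mW] S := (measurable_fst.comp measurable_snd).comp hWW
  have hY0W : Measurable[mW] Y0 :=
    (measurable_fst.comp (measurable_snd.comp measurable_snd)).comp hWW
  have hY1W : Measurable[mW] Y1 :=
    (measurable_snd.comp (measurable_snd.comp measurable_snd)).comp hWW
  have hind : Indep mW (MeasurableSpace.comap Z inferInstance) P := hindep.symm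
  have hevZ (b : Bool) :
      MeasurableSet[MeasurableSpace.comap Z inferInstance] {ω | Z ω = b} :=
    ⟨{b}, measurableSet_singleton b, rfl⟩
  have hevS : MeasurableSet[mW] {ω | S ω = true} := hSW (measurableSet_singleton true)
  have hevS' : MeasurableSet[mΩ] {ω | S ω = true} := hmW_le _ hevS
  have hs_ind : s = {ω | S ω = true}.indicator 1 := by
    ext ω; simp [hs, Set.indicator_apply]
  have hs_meas : StronglyMeasurable[m'] s := by
    rw [hs_ind]
    exact stronglyMeasurable_one.indicator
      (le_sup_left (a := MeasurableSpace.comap S inferInstance) (b := m) _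
        ⟨{true}, measurableSet_singleton true, rfl⟩)
  have hs_bdd (ω : Ω) : |s ω| ≤ (1 : ℝ) := by
    by_cases h : S ω = true <;> simp [hs, h]
  have hpi_meas : StronglyMeasurable[mW] (P[s | m]) :=
    stronglyMeasurable_condExp.mono hXW.comap_le
  have hpiY0 : Integrable (fun ω => (P[s | m]) ω * Y0 ω) P :=
    hY0.bdd_mul (hpi_meas.mono hmW_le).aestronglyMeasurable
      (ae_bdd_abs_condExp_of_ae_bdd_abs (.of_forall hs_bdd))
  have hZ0 : P {ω | Z ω = false} ≠ 0 := by
    have hcompl : {ω | Z ω = false} = {ω | Z ω = true}ᶜ := by ext ω; simp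
    rw [hcompl, Ne, prob_compl_eq_zero_iff (hZ_le _ (hevZ true))]
    exact hZlt.ne
  have hsum (Y : Ω → ℝ) : ∫ ω, s ω * Y ω ∂P = ∫ ω in {ω | S ω = true}, Y ω ∂P := by
    rw [← integral_indicator hevS']
    congr 1 with ω
    simp [hs, Set.indicator_apply]
  have htreated :
      ∫ ω, (if Z ω then Y1 ω else Y0 ω) ∂(P[|{ω | Z ω = true} ∩ {ω | S ω = true}])
        = ∫ ω, Y1 ω ∂(P[|{ω | S ω = true}]) := by
    rw [← integral_cond_inter_of_indep hmW_le hZ_le hind hY1W.stronglyMeasurable hY1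
      (hevZ true) hevS hZpos.ne']
    refine integral_congr_ae ?_
    filter_upwards [ae_cond_mem ((hZ_le _ (hevZ true)).inter hevS')] with ω hω
    rw [if_pos (show Z ω = true from hω.1)]
  have hcontrol :
      ∫ ω, (P[s | m]) ω * (if Z ω then Y1 ω else Y0 ω) ∂(P[|{ω | Z ω = false}])
        = ∫ ω in {ω | S ω = true}, Y0 ω ∂P := by
    rw [← hsum, ← integral_condExp_mul_of_condExp_eq hm hm' hs_meas hY0 1 hs_bdd hWPI]
    refine .trans (integral_congr_ae ?_) (integral_cond_of_indep hmW_le hZ_le hind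
      (hpi_meas.mul hY0W.stronglyMeasurable) hpiY0 (hevZ false) hZ0)
    filter_upwards [ae_cond_mem (hZ_le _ (hevZ false))] with ω hω
    simp [show Z ω = false from hω]
  have hweight : ∫ ω, (P[s | m]) ω ∂(P[|{ω | Z ω = false}]) = P.real {ω | S ω = true} := by
    rw [integral_cond_of_indep hmW_le hZ_le hind hpi_meas integrable_condExp (hevZ false) hZ0,
      integral_condExp hm, hs_ind, integral_indicator_one hevS']
  rw [htreated, hcontrol, hweight, integral_cond_eq_inv_mul_setIntegral,
    integral_cond_eq_inv_mul_setIntegral, integral_sub hY1.integrableOn hY0.integrableOn]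
  ring
end

section
/- Identification of the principal causal effect on High Takers by the weighting method under Strong Principal Ignorability: assume randomization (Z independent of (X, S, Y0, Y1) with 0 < P(Z = true) < 1), P(S = true) > 0, and Strong Principal Ignorability, i.e. E[Y0 | σ(S) ⊔ σ(X)] = E[Y0 | σ(X)] P-a.s. and E[Y1 | σ(S) ⊔ σ(X)] = E[Y1 | σ(X)] P-a.s. Then, with π := E[1_{S} | σ(X)] and observed outcome Y := if Z then Y1 else Y0, one has E[π · Y | Z = true] / E[π | Z = true] − E[π · Y | Z = false] / E[π | Z = false] = E[Y1 − Y0 | S = true]. -/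
open MeasureTheory ProbabilityTheory

/-- Conditioning on an event of positive probability that is independent of a sub-σ-algebra
does not change the expectation of a variable measurable with respect to that sub-σ-algebra. -/
lemma integral_cond_eq_integral_of_indepFun {Ω β γ : Type*} {mΩ : MeasurableSpace Ω}
    [MeasurableSpace β] [MeasurableSpace γ] {P : Measure Ω} [IsProbabilityMeasure P]
    {Z : Ω → β} {V : Ω → γ} {W : Ω → ℝ} {t : Set β} (hZ : Measurable Z) (hV : Measurable V)
    (hindep : IndepFun Z V P)
    (hW : Measurable[MeasurableSpace.comap V inferInstance] W) (ht : MeasurableSet t)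
    (h0 : P (Z ⁻¹' t) ≠ 0) :
    ∫ ω, W ω ∂(P[|Z ⁻¹' t]) = ∫ ω, W ω ∂P := by
  have hZW : Indep (MeasurableSpace.comap Z inferInstance)
      (MeasurableSpace.comap W inferInstance) P :=
    indep_of_indep_of_le_right hindep hW.comap_le
  have hWm : Measurable W := hW.mono hV.comap_le le_rfl
  have key := hZW.setIntegral_eq_mul hZ.comap_le (f := id) hWm.aemeasurable
    ⟨t, ht, rfl⟩ aestronglyMeasurable_id
  have hpos : P.real (Z ⁻¹' t) ≠ 0 := by simpa [Measure.real, ENNReal.toReal_eq_zero_iff] using h0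
  simp only [id] at key
  rw [ProbabilityTheory.cond, integral_smul_measure, key, ENNReal.toReal_inv, smul_eq_mul,
    ← Measure.real, inv_mul_cancel_left₀ hpos]

/-- The conditional expectation given a sub-σ-algebra is self-adjoint on pairs consisting of a
bounded and an integrable function. -/
lemma integral_condExp_mul_eq_integral_mul_condExp {Ω : Type*} {m mΩ : MeasurableSpace Ω}
    {P : Measure Ω} [IsFiniteMeasure P] (hm : m ≤ mΩ) {f g : Ω → ℝ} {c : ℝ}
    (hf : AEStronglyMeasurable f P) (hfb : ∀ᵐ ω ∂P, |f ω| ≤ c) (hg : Integrable g P) :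
    ∫ ω, (P[f | m]) ω * g ω ∂P = ∫ ω, f ω * (P[g | m]) ω ∂P := by
  have hfi : Integrable f P := .of_bound hf c hfb
  have hb : ∀ᵐ ω ∂P, ‖(P[f | m]) ω‖ ≤ c := ae_bdd_abs_condExp_of_ae_bdd_abs hfb
  have h₁ := condExp_mul_of_stronglyMeasurable_left (m := m) (μ := P)
    (stronglyMeasurable_condExp (f := f)) (hg.bdd_mul integrable_condExp.aestronglyMeasurable hb) hg
  have h₂ := condExp_mul_of_stronglyMeasurable_right (m := m) (μ := P)
    (stronglyMeasurable_condExp (f := g)) (integrable_condExp.bdd_mul hf hfb) hfi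
  calc ∫ ω, (P[f | m]) ω * g ω ∂P = ∫ ω, (P[P[f | m] * g | m]) ω ∂P := (integral_condExp hm).symm
    _ = ∫ ω, (P[f * P[g | m] | m]) ω ∂P := integral_congr_ae (h₁.trans h₂.symm)
    _ = ∫ ω, f ω * (P[g | m]) ω ∂P := integral_condExp hm

/-- If the conditional expectation of `g` given a larger σ-algebra `m'` agrees with the one given
`m`, then for every `m'`-event weighting `g` by the conditional probability of the event given `m`
is the same as integrating `g` over the event. -/
lemma integral_condExp_indicator_mul_eq_setIntegral {Ω : Type*} {m m' mΩ : MeasurableSpace Ω}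
    {P : Measure Ω} [IsFiniteMeasure P] (hm : m ≤ mΩ) (hm' : m' ≤ mΩ) {A : Set Ω}
    (hA : MeasurableSet[m'] A) {g : Ω → ℝ} (hg : Integrable g P) (h : P[g | m'] =ᵐ[P] P[g | m]) :
    ∫ ω, (P[A.indicator 1 | m]) ω * g ω ∂P = ∫ ω in A, g ω ∂P := by
  have hA' : MeasurableSet A := hm' A hA
  have hb : ∀ ω, |A.indicator (1 : Ω → ℝ) ω| ≤ 1 := fun ω => by
    by_cases hω : ω ∈ A <;> simp [hω]
  have hind : ∀ ω, A.indicator (1 : Ω → ℝ) ω * (P[g | m]) ω = A.indicator (P[g | m]) ω :=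
    fun ω => by by_cases hω : ω ∈ A <;> simp [hω]
  rw [integral_condExp_mul_eq_integral_mul_condExp hm
      (measurable_one.indicator hA').aestronglyMeasurable (.of_forall hb) hg,
    ← setIntegral_condExp hm' hg hA, integral_congr_ae (.of_forall hind),
    integral_indicator hA']
  exact integral_congr_ae (ae_restrict_of_ae h.symm)

/-- Identification of the principal causal effect on High Takers by the weighting
method under Strong Principal Ignorability:
`E[π·Y | Z = 1] / E[π | Z = 1] − E[π·Y | Z = 0] / E[π | Z = 0] = E[Y1 − Y0 | S = 1]`. -/
theorem weighting_identification_strong_PI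
    {Ω 𝒳 : Type*} {mΩ : MeasurableSpace Ω} {m𝒳 : MeasurableSpace 𝒳}
    (P : Measure Ω) [IsProbabilityMeasure P]
    (X : Ω → 𝒳) (S Z : Ω → Bool) (Y0 Y1 : Ω → ℝ)
    (hX : Measurable X) (hS : Measurable S) (hZ : Measurable Z)
    (hY0m : Measurable Y0) (hY1m : Measurable Y1)
    (hY0 : Integrable Y0 P) (hY1 : Integrable Y1 P)
    (hindep : IndepFun Z (fun ω => (X ω, S ω, Y0 ω, Y1 ω)) P)
    (hZpos : 0 < P {ω | Z ω = true}) (hZlt : P {ω | Z ω = true} < 1)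
    (hSpos : 0 < P {ω | S ω = true})
    (hSPI0 : P[Y0 | MeasurableSpace.comap S inferInstance ⊔ MeasurableSpace.comap X m𝒳]
        =ᵐ[P] P[Y0 | MeasurableSpace.comap X m𝒳])
    (hSPI1 : P[Y1 | MeasurableSpace.comap S inferInstance ⊔ MeasurableSpace.comap X m𝒳]
        =ᵐ[P] P[Y1 | MeasurableSpace.comap X m𝒳]) :
    (∫ ω, (P[(fun ω' => if S ω' then (1 : ℝ) else 0) | MeasurableSpace.comap X m𝒳]) ω
          * (if Z ω then Y1 ω else Y0 ω) ∂(P[|{ω | Z ω = true}]))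
      / (∫ ω, (P[(fun ω' => if S ω' then (1 : ℝ) else 0) | MeasurableSpace.comap X m𝒳]) ω
          ∂(P[|{ω | Z ω = true}]))
    - (∫ ω, (P[(fun ω' => if S ω' then (1 : ℝ) else 0) | MeasurableSpace.comap X m𝒳]) ω
          * (if Z ω then Y1 ω else Y0 ω) ∂(P[|{ω | Z ω = false}]))
      / (∫ ω, (P[(fun ω' => if S ω' then (1 : ℝ) else 0) | MeasurableSpace.comap X m𝒳]) ω
          ∂(P[|{ω | Z ω = false}]))
      = ∫ ω, (Y1 ω - Y0 ω) ∂(P[|{ω | S ω = true}]) := by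
  set V : Ω → 𝒳 × Bool × ℝ × ℝ := fun ω => (X ω, S ω, Y0 ω, Y1 ω)
  have hV : Measurable V := hX.prodMk (hS.prodMk (hY0m.prodMk hY1m))
  have hSm : MeasurableSet (S ⁻¹' {true}) := hS (measurableSet_singleton _)
  have hZm : ∀ b, MeasurableSet (Z ⁻¹' {b}) := fun b => hZ (measurableSet_singleton b)
  set m := MeasurableSpace.comap X m𝒳
  have hm : m ≤ mΩ := hX.comap_le
  have hV' : Measurable[MeasurableSpace.comap V inferInstance] V := comap_measurable V
  have hmV : m ≤ MeasurableSpace.comap V inferInstance :=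
    (measurable_fst.comp hV').comap_le
  have hY0V : Measurable[MeasurableSpace.comap V inferInstance] Y0 :=
    hV'.snd.snd.fst
  have hY1V : Measurable[MeasurableSpace.comap V inferInstance] Y1 :=
    hV'.snd.snd.snd
  have hπ_eq : (fun ω' => if S ω' then (1 : ℝ) else 0) = (S ⁻¹' {true}).indicator 1 := by
    ext ω
    simp [Set.indicator]
  rw [hπ_eq]
  set π := P[(S ⁻¹' {true}).indicator (1 : Ω → ℝ) | m] with hπ_def
  have hπ : Measurable[MeasurableSpace.comap V inferInstance] π :=
    stronglyMeasurable_condExp.measurable.mono hmV le_rfl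
  have hZ0 : ∀ b, P (Z ⁻¹' {b}) ≠ 0 := by
    rintro (_ | _)
    · have : Z ⁻¹' {false} = (Z ⁻¹' {true})ᶜ := by ext; simp
      rw [this, Ne, prob_compl_eq_zero_iff (hZm true)]
      exact hZlt.ne
    · exact hZpos.ne'
  have hobs : ∀ b, ∫ ω, π ω * (if Z ω then Y1 ω else Y0 ω) ∂(P[|Z ⁻¹' {b}])
      = ∫ ω, π ω * (if b then Y1 ω else Y0 ω) ∂(P[|Z ⁻¹' {b}]) := fun b =>
    integral_congr_ae <| (ae_cond_mem (hZm b)).mono fun ω (hω : Z ω = b) => by simp only [hω]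
  have hcond : ∀ b {W : Ω → ℝ}, Measurable[MeasurableSpace.comap V inferInstance] W →
      ∫ ω, W ω ∂(P[|Z ⁻¹' {b}]) = ∫ ω, W ω ∂P := fun b _ hW =>
    integral_cond_eq_integral_of_indepFun hZ hV hindep hW (measurableSet_singleton b) (hZ0 b)
  have hSm' : MeasurableSet[MeasurableSpace.comap S inferInstance ⊔ m] (S ⁻¹' {true}) :=
    le_sup_left (a := MeasurableSpace.comap S inferInstance) _
      ⟨{true}, measurableSet_singleton _, rfl⟩
  have hm' : MeasurableSpace.comap S inferInstance ⊔ m ≤ mΩ := sup_le hS.comap_le hm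
  have h0 : ∫ ω, π ω * Y0 ω ∂P = ∫ ω in S ⁻¹' {true}, Y0 ω ∂P :=
    integral_condExp_indicator_mul_eq_setIntegral hm hm' hSm' hY0 hSPI0
  have h1 : ∫ ω, π ω * Y1 ω ∂P = ∫ ω in S ⁻¹' {true}, Y1 ω ∂P :=
    integral_condExp_indicator_mul_eq_setIntegral hm hm' hSm' hY1 hSPI1
  have hπ_int : ∫ ω, π ω ∂P = P.real (S ⁻¹' {true}) := by
    rw [hπ_def, integral_condExp hm, integral_indicator_one hSm]
  change (∫ ω, π ω * (if Z ω then Y1 ω else Y0 ω) ∂(P[|Z ⁻¹' {true}]))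
      / (∫ ω, π ω ∂(P[|Z ⁻¹' {true}]))
    - (∫ ω, π ω * (if Z ω then Y1 ω else Y0 ω) ∂(P[|Z ⁻¹' {false}]))
      / (∫ ω, π ω ∂(P[|Z ⁻¹' {false}]))
    = ∫ ω, (Y1 ω - Y0 ω) ∂(P[|S ⁻¹' {true}])
  simp only [hobs, if_true, Bool.false_eq_true, if_false]
  rw [hcond _ (W := fun ω => π ω * Y1 ω) (hπ.mul hY1V),
    hcond _ (W := fun ω => π ω * Y0 ω) (hπ.mul hY0V), hcond _ hπ, hcond _ hπ, h0, h1, hπ_int,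
    ProbabilityTheory.cond, integral_smul_measure,
    integral_sub hY1.integrableOn hY0.integrableOn, ENNReal.toReal_inv, smul_eq_mul,
    ← Measure.real]
  ring
end

section
/- Bias of the discrete subgroup method: under the hypotheses of the binary-covariate Strong Principal Ignorability decomposition (X : Ω → Bool with both values of positive probability, P(S = true) > 0, and E[Yz | {X = x} ∩ {S = s}] = E[Yz | X = x] for z ∈ {0,1} and all positive-probability combinations), writing τ_x := E[Y1 − Y0 | X = x], one has E[Y1 − Y0 | S = true] − τ_f = P(X = false | S = true) · (τ_m − τ_f), where τ_f := τ_{true} and τ_m := τ_{false}. Consequently the subgroup estimand τ_f equals the principal causal effect E[Y1 − Y0 | S = true] if and only if P({X = false} ∩ {S = true}) = 0 or τ_f = τ_m. -/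
open MeasureTheory ProbabilityTheory

/-- The conditional expectation given an event, weighted by its probability, is the integral over
the event; this includes null events. -/
lemma measureReal_mul_integral_cond {Ω : Type*} {mΩ : MeasurableSpace Ω}
    (P : Measure Ω) [IsFiniteMeasure P] (A : Set Ω) (f : Ω → ℝ) :
    P.real A * ∫ ω, f ω ∂(P[|A]) = ∫ ω in A, f ω ∂P := by
  by_cases h : P A = 0
  · simp [Measure.real, h, Measure.restrict_eq_zero.mpr h]
  · have h' : P.real A ≠ 0 := ENNReal.toReal_ne_zero.mpr ⟨h, measure_ne_top P A⟩
    rw [ProbabilityTheory.cond, integral_smul_measure, ENNReal.toReal_inv, smul_eq_mul]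
    exact mul_inv_cancel_left₀ h' _

/-- Law of total expectation for a binary covariate within a subpopulation on which the
covariate-specific conditional means are `m`. -/
lemma measureReal_mul_integral_cond_eq_of_bool {Ω : Type*} {mΩ : MeasurableSpace Ω}
    (P : Measure Ω) [IsFiniteMeasure P] {X : Ω → Bool} (hX : Measurable X) (B : Set Ω)
    {f : Ω → ℝ} (hf : Integrable f P) (m : Bool → ℝ)
    (hm : ∀ x, 0 < P ({ω | X ω = x} ∩ B) → ∫ ω, f ω ∂(P[|{ω | X ω = x} ∩ B]) = m x) :
    P.real B * ∫ ω, f ω ∂(P[|B])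
      = P.real ({ω | X ω = true} ∩ B) * m true + P.real ({ω | X ω = false} ∩ B) * m false := by
  have hc : {ω | X ω = true}ᶜ = {ω | X ω = false} := by ext ω; simp
  have ht : MeasurableSet {ω | X ω = true} := hX (measurableSet_singleton true)
  have hcell : ∀ x, P.real ({ω | X ω = x} ∩ B) * m x = ∫ ω in {ω | X ω = x} ∩ B, f ω ∂P := by
    intro x
    rw [← measureReal_mul_integral_cond]
    rcases eq_zero_or_pos (P ({ω | X ω = x} ∩ B)) with h | h
    · simp [Measure.real, h]
    · rw [hm x h]
  rw [measureReal_mul_integral_cond, hcell, hcell, ← integral_inter_add_sdiff ht hf.integrableOn,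
    Set.sdiff_eq, hc, Set.inter_comm B, Set.inter_comm B]

/-- Bias of the discrete subgroup method: under the binary-covariate Strong
Principal Ignorability hypotheses, with `τ_x := E[Y1 − Y0 | X = x]`,
`E[Y1 − Y0 | S = true] − τ_f = P(X = false | S = true)·(τ_m − τ_f)`;
consequently `τ_f = E[Y1 − Y0 | S = true]` iff `P(X = false, S = true) = 0` or
`τ_f = τ_m`. -/
theorem discrete_subgroup_method_bias
    {Ω : Type*} {mΩ : MeasurableSpace Ω}
    (P : Measure Ω) [IsProbabilityMeasure P]
    (X S : Ω → Bool) (Y0 Y1 : Ω → ℝ)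
    (hX : Measurable X) (hS : Measurable S)
    (hY0 : Integrable Y0 P) (hY1 : Integrable Y1 P)
    (hpf : 0 < P {ω | X ω = true}) (hpm : 0 < P {ω | X ω = false})
    (hSpos : 0 < P {ω | S ω = true})
    (hMI0 : ∀ x s : Bool, 0 < P ({ω | X ω = x} ∩ {ω | S ω = s}) →
      (∫ ω, Y0 ω ∂(P[|{ω | X ω = x} ∩ {ω | S ω = s}]))
        = ∫ ω, Y0 ω ∂(P[|{ω | X ω = x}]))
    (hMI1 : ∀ x s : Bool, 0 < P ({ω | X ω = x} ∩ {ω | S ω = s}) →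
      (∫ ω, Y1 ω ∂(P[|{ω | X ω = x} ∩ {ω | S ω = s}]))
        = ∫ ω, Y1 ω ∂(P[|{ω | X ω = x}])) :
    (∫ ω, (Y1 ω - Y0 ω) ∂(P[|{ω | S ω = true}]))
        - (∫ ω, (Y1 ω - Y0 ω) ∂(P[|{ω | X ω = true}]))
      = (P[|{ω | S ω = true}] {ω | X ω = false}).toReal
          * ((∫ ω, (Y1 ω - Y0 ω) ∂(P[|{ω | X ω = false}]))
            - (∫ ω, (Y1 ω - Y0 ω) ∂(P[|{ω | X ω = true}])))
    ∧ ((∫ ω, (Y1 ω - Y0 ω) ∂(P[|{ω | X ω = true}]))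
          = (∫ ω, (Y1 ω - Y0 ω) ∂(P[|{ω | S ω = true}]))
        ↔ P ({ω | X ω = false} ∩ {ω | S ω = true}) = 0
          ∨ (∫ ω, (Y1 ω - Y0 ω) ∂(P[|{ω | X ω = true}]))
              = (∫ ω, (Y1 ω - Y0 ω) ∂(P[|{ω | X ω = false}]))) := by
  have hf : MeasurableSet {ω | X ω = true} := hX (measurableSet_singleton true)
  have hSm : MeasurableSet {ω | S ω = true} := hS (measurableSet_singleton true)
  have hS0 : P.real {ω | S ω = true} ≠ 0 :=
    ENNReal.toReal_ne_zero.mpr ⟨hSpos.ne', measure_ne_top P _⟩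
  have hcond : ∀ {f : Ω → ℝ}, Integrable f P → ∀ {A : Set Ω}, 0 < P A → Integrable f (P[|A]) :=
    fun hint _ hA => hint.restrict.smul_measure (ENNReal.inv_ne_top.mpr hA.ne')
  have htau : ∀ x, 0 < P ({ω | X ω = x} ∩ {ω | S ω = true}) →
      ∫ ω, (Y1 ω - Y0 ω) ∂(P[|{ω | X ω = x} ∩ {ω | S ω = true}])
        = ∫ ω, (Y1 ω - Y0 ω) ∂(P[|{ω | X ω = x}]) := by
    intro x hx
    have hx' : 0 < P {ω | X ω = x} := hx.trans_le (measure_mono Set.inter_subset_left)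
    rw [integral_sub (hcond hY1 hx) (hcond hY0 hx), integral_sub (hcond hY1 hx') (hcond hY0 hx'),
      hMI0 x true hx, hMI1 x true hx]
  have htotal := measureReal_mul_integral_cond_eq_of_bool P hX {ω | S ω = true} (hY1.sub hY0)
    (fun x => ∫ ω, (Y1 ω - Y0 ω) ∂(P[|{ω | X ω = x}])) htau
  simp only [Pi.sub_apply] at htotal
  have hmass : P.real {ω | S ω = true} = P.real ({ω | X ω = true} ∩ {ω | S ω = true})
      + P.real ({ω | X ω = false} ∩ {ω | S ω = true}) := by
    have hc : {ω | X ω = true}ᶜ = {ω | X ω = false} := by ext ω; simp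
    rw [← measureReal_inter_add_sdiff (s := {ω | S ω = true}) hf, Set.sdiff_eq, hc,
      Set.inter_comm {ω | S ω = true}, Set.inter_comm {ω | S ω = true}]
  have hshare : (P[|{ω | S ω = true}] {ω | X ω = false}).toReal
      = P.real ({ω | X ω = false} ∩ {ω | S ω = true}) / P.real {ω | S ω = true} := by
    rw [cond_apply hSm, ENNReal.toReal_mul, ENNReal.toReal_inv, Set.inter_comm, div_eq_inv_mul]
    rfl
  have hbias : (∫ ω, (Y1 ω - Y0 ω) ∂(P[|{ω | S ω = true}]))
        - (∫ ω, (Y1 ω - Y0 ω) ∂(P[|{ω | X ω = true}]))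
      = (P[|{ω | S ω = true}] {ω | X ω = false}).toReal
          * ((∫ ω, (Y1 ω - Y0 ω) ∂(P[|{ω | X ω = false}]))
            - (∫ ω, (Y1 ω - Y0 ω) ∂(P[|{ω | X ω = true}]))) := by
    rw [hshare, div_mul_eq_mul_div, eq_div_iff hS0]
    linear_combination htotal - (∫ ω, (Y1 ω - Y0 ω) ∂(P[|{ω | X ω = true}])) * hmass
  refine ⟨hbias, ?_⟩
  rw [eq_comm, ← sub_eq_zero, hbias, mul_eq_zero, hshare, div_eq_zero_iff, or_iff_left hS0,
    measureReal_eq_zero_iff, sub_eq_zero, eq_comm (a := ∫ ω, (Y1 ω - Y0 ω) ∂(P[|{ω | X ω = true}]))]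
end

section
/- Identification of the Complier control mean by principal-score weighting under Weak Principal Ignorability on the control side: assume monotonicity (D0 ≤ D1 pointwise), P(D0 = false, D1 = true) > 0, and the weak ignorability condition that E[Y0 | σ(X) ⊔ σ(D0) ⊔ σ(D1)] = E[Y0 | σ(X) ⊔ σ(D0)] holds P-almost surely on the event {D0 = false}. Define π_n := E[1_{D1 = false} | σ(X)], π_c := E[1_{D0 = false, D1 = true} | σ(X)], and ψ := π_c / (π_c + π_n) (with an arbitrary value where the denominator vanishes). Then E[ψ · Y0 · 1_{D0 = false}] = E[Y0 · 1_{D0 = false, D1 = true}] and E[ψ · 1_{D0 = false}] = P(D0 = false, D1 = true); in particular E[Y0 | {D0 = false} ∩ {D1 = true}] = E[ψ · Y0 · 1_{D0 = false}] / E[ψ · 1_{D0 = false}]. -/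
open MeasureTheory ProbabilityTheory

/-- Moving a conditional expectation onto one factor of an integral, when the other factor is
measurable for the conditioning σ-algebra. -/
theorem integral_mul_condExp_of_stronglyMeasurable_left {Ω : Type*} {m mΩ : MeasurableSpace Ω}
    {μ : Measure Ω} [IsFiniteMeasure μ] (hm : m ≤ mΩ) {f g : Ω → ℝ} (hf : StronglyMeasurable[m] f)
    (hfg : Integrable (fun ω => f ω * g ω) μ) (hg : Integrable g μ) :
    ∫ ω, f ω * (μ[g|m]) ω ∂μ = ∫ ω, f ω * g ω ∂μ := by
  rw [← integral_condExp hm (f := fun ω => f ω * g ω)]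
  exact integral_congr_ae (condExp_mul_of_stronglyMeasurable_left hf hfg hg).symm

/-- On a level set of `D`, every event of `σ(X) ⊔ σ(D)` coincides with an event of `σ(X)`. -/
theorem exists_measurableSet_comap_of_sup_comap {Ω 𝒳 𝒟 : Type*} {m𝒳 : MeasurableSpace 𝒳}
    {m𝒟 : MeasurableSpace 𝒟} (X : Ω → 𝒳) (D : Ω → 𝒟) (d : 𝒟) {s : Set Ω}
    (hs : MeasurableSet[MeasurableSpace.comap X m𝒳 ⊔ MeasurableSpace.comap D m𝒟] s) :
    ∃ t, MeasurableSet[MeasurableSpace.comap X m𝒳] t ∧ ∀ ω, D ω = d → (ω ∈ s ↔ ω ∈ t) := by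
  rw [← MeasurableSpace.comap_prodMk] at hs
  obtain ⟨T, hT, rfl⟩ := hs
  refine ⟨X ⁻¹' {x | (x, d) ∈ T}, ⟨_, measurable_prodMk_right hT, rfl⟩, ?_⟩
  rintro ω rfl
  rfl

/-- The ratio of conditional expectations of nonnegative functions `π_c / (π_c + π_n)` lies in
`[0, 1]` almost surely. -/
theorem condExp_div_add_mem_Icc {Ω : Type*} {m mΩ : MeasurableSpace Ω} {μ : Measure Ω}
    {c n : Ω → ℝ} (hc : 0 ≤ c) (hn : 0 ≤ n) :
    ∀ᵐ ω ∂μ, (μ[c|m]) ω / ((μ[c|m]) ω + (μ[n|m]) ω) ∈ Set.Icc (0 : ℝ) 1 := by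
  filter_upwards [condExp_nonneg (m := m) (μ := μ) (.of_forall hc),
    condExp_nonneg (m := m) (μ := μ) (.of_forall hn)] with ω h1 h2
  simp only [Pi.zero_apply] at h1 h2
  exact ⟨by positivity, div_le_one_of_le₀ (by linarith) (by linarith)⟩

/-- If `c, n ≥ 0` and `c + n` is the indicator of `{D = d}`, then conditionally on
`σ(X) ⊔ σ(D)` the expectation of `c` is `π_c / (π_c + π_n)` on `{D = d}` and `0` elsewhere, where
`π_c` and `π_n` are the conditional expectations of `c` and `n` given `σ(X)`. -/
theorem condExp_sup_comap_eq_condExp_div_add {Ω 𝒳 𝒟 : Type*} {mΩ : MeasurableSpace Ω}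
    {m𝒳 : MeasurableSpace 𝒳} {m𝒟 : MeasurableSpace 𝒟} [MeasurableSingletonClass 𝒟]
    [DecidableEq 𝒟] {μ : Measure Ω} [IsFiniteMeasure μ] {X : Ω → 𝒳} {D : Ω → 𝒟}
    (hX : Measurable X) (hD : Measurable D) (d : 𝒟) {c n : Ω → ℝ}
    (hc : 0 ≤ c) (hn : 0 ≤ n) (hci : Integrable c μ) (hni : Integrable n μ)
    (hadd : ∀ ω, c ω + n ω = if D ω = d then 1 else 0) :
    (fun ω => (μ[c|MeasurableSpace.comap X m𝒳]) ω /
        ((μ[c|MeasurableSpace.comap X m𝒳]) ω + (μ[n|MeasurableSpace.comap X m𝒳]) ω)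
        * (if D ω = d then 1 else 0))
      =ᵐ[μ] μ[c|MeasurableSpace.comap X m𝒳 ⊔ MeasurableSpace.comap D m𝒟] := by
  have hG := hX.comap_le
  have hH : MeasurableSpace.comap X m𝒳 ⊔ MeasurableSpace.comap D m𝒟 ≤ mΩ :=
    sup_le hG hD.comap_le
  set ψ : Ω → ℝ := fun ω => (μ[c|MeasurableSpace.comap X m𝒳]) ω /
        ((μ[c|MeasurableSpace.comap X m𝒳]) ω + (μ[n|MeasurableSpace.comap X m𝒳]) ω) with hψ
  have hψm : StronglyMeasurable[MeasurableSpace.comap X m𝒳] ψ :=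
    (stronglyMeasurable_condExp.measurable.div (stronglyMeasurable_condExp.measurable.add
      stronglyMeasurable_condExp.measurable)).stronglyMeasurable
  have hψa : ∀ ω, ψ ω * (if D ω = d then 1 else 0) = ψ ω * (c + n) ω := fun ω => by
    rw [Pi.add_apply, hadd]
  have hint : Integrable (fun ω => ψ ω * (c + n) ω) μ := by
    refine (hci.add hni).bdd_mul (c := 1) (hψm.mono hG).aestronglyMeasurable ?_
    filter_upwards [condExp_div_add_mem_Icc (m := MeasurableSpace.comap X m𝒳) hc hn] with ω h
    rw [Real.norm_eq_abs, abs_of_nonneg h.1]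
    exact h.2
  change (fun ω => ψ ω * (if D ω = d then 1 else 0)) =ᵐ[μ] _
  simp_rw [hψa]
  refine ae_eq_condExp_of_forall_setIntegral_eq hH hci (fun s _ _ => hint.integrableOn) ?_ ?_
  · intro s hs _
    obtain ⟨t, ht, hst⟩ := exists_measurableSet_comap_of_sup_comap X D d hs
    have hres : ∀ f : Ω → ℝ, (∀ ω, D ω ≠ d → f ω = 0) → ∫ ω in s, f ω ∂μ = ∫ ω in t, f ω ∂μ := by
      intro f hf
      rw [← integral_indicator (hH s hs), ← integral_indicator (hG t ht)]
      congr 1 with ω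
      by_cases h : D ω = d
      · by_cases ht : ω ∈ t
        · rw [Set.indicator_of_mem ht, Set.indicator_of_mem ((hst ω h).2 ht)]
        · rw [Set.indicator_of_notMem ht, Set.indicator_of_notMem fun hs => ht ((hst ω h).1 hs)]
      · simp [Set.indicator, hf ω h]
    have hc0 : ∀ ω, D ω ≠ d → c ω = 0 := fun ω h => by
      have h1 := hadd ω
      rw [if_neg h] at h1
      have h2 : 0 ≤ c ω := hc ω
      have h3 : 0 ≤ n ω := hn ω
      linarith
    rw [hres _ fun ω h => by rw [← hψa, if_neg h, mul_zero], hres _ hc0,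
      ← setIntegral_condExp hG hci ht, ← setIntegral_condExp hG hint ht]
    refine setIntegral_congr_ae (hG t ht) ?_
    filter_upwards [condExp_mul_of_stronglyMeasurable_left hψm hint (hci.add hni),
      condExp_add hci hni (MeasurableSpace.comap X m𝒳),
      condExp_nonneg (m := MeasurableSpace.comap X m𝒳) (μ := μ) (.of_forall hc),
      condExp_nonneg (m := MeasurableSpace.comap X m𝒳) (μ := μ) (.of_forall hn)]
      with ω h1 h2 h3 h4 _
    refine h1.trans ?_
    simp only [Pi.zero_apply] at h3 h4
    rw [Pi.mul_apply, h2, Pi.add_apply, hψ]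
    exact div_mul_cancel_of_imp fun h => by linarith
  · have hDm : Measurable[MeasurableSpace.comap X m𝒳 ⊔ MeasurableSpace.comap D m𝒟] D :=
      (comap_measurable D).mono le_sup_right le_rfl
    simp_rw [← hψa]
    have hite : StronglyMeasurable[MeasurableSpace.comap X m𝒳 ⊔ MeasurableSpace.comap D m𝒟]
        fun ω => if D ω = d then (1 : ℝ) else 0 :=
      (Measurable.ite (hDm (measurableSet_singleton d))
        measurable_const measurable_const).stronglyMeasurable
    have hψH : StronglyMeasurable[MeasurableSpace.comap X m𝒳 ⊔ MeasurableSpace.comap D m𝒟] ψ :=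
      hψm.mono le_sup_left
    exact (hψH.mul hite).aestronglyMeasurable

/-- Identification of the Complier control mean by principal-score weighting under
Weak Principal Ignorability on the control side, with `ψ := π_c / (π_c + π_n)`:
`E[ψ·Y0·1_{D0 = false}] = E[Y0·1_{Complier}]`, `E[ψ·1_{D0 = false}] = P(Complier)`,
and `E[Y0 | Complier] = E[ψ·Y0·1_{D0 = false}] / E[ψ·1_{D0 = false}]`. -/
theorem complier_control_mean_weighting_weak_PI
    {Ω 𝒳 : Type*} {mΩ : MeasurableSpace Ω} {m𝒳 : MeasurableSpace 𝒳}
    (P : Measure Ω) [IsProbabilityMeasure P]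
    (X : Ω → 𝒳) (D0 D1 : Ω → Bool) (Y0 : Ω → ℝ)
    (hX : Measurable X) (hD0 : Measurable D0) (hD1 : Measurable D1)
    (hY0m : Measurable Y0) (hY0 : Integrable Y0 P)
    (hmono : ∀ ω, D0 ω = true → D1 ω = true)
    (hcpos : 0 < P {ω | D0 ω = false ∧ D1 ω = true})
    (hWPI : ∀ᵐ ω ∂P, D0 ω = false →
      (P[Y0 | MeasurableSpace.comap X m𝒳 ⊔ MeasurableSpace.comap D0 inferInstance
            ⊔ MeasurableSpace.comap D1 inferInstance]) ω
        = (P[Y0 | MeasurableSpace.comap X m𝒳 ⊔ MeasurableSpace.comap D0 inferInstance]) ω) :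
    let π_n := P[(fun ω => if D1 ω = false then (1 : ℝ) else 0) | MeasurableSpace.comap X m𝒳]
    let π_c := P[(fun ω => if D0 ω = false ∧ D1 ω = true then (1 : ℝ) else 0) |
        MeasurableSpace.comap X m𝒳]
    let ψ := fun ω => π_c ω / (π_c ω + π_n ω)
    (∫ ω, ψ ω * Y0 ω * (if D0 ω = false then (1 : ℝ) else 0) ∂P)
        = ∫ ω, Y0 ω * (if D0 ω = false ∧ D1 ω = true then (1 : ℝ) else 0) ∂P
      ∧ (∫ ω, ψ ω * (if D0 ω = false then (1 : ℝ) else 0) ∂P)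
        = (P {ω | D0 ω = false ∧ D1 ω = true}).toReal
      ∧ (∫ ω, Y0 ω ∂(P[|{ω | D0 ω = false} ∩ {ω | D1 ω = true}]))
        = (∫ ω, ψ ω * Y0 ω * (if D0 ω = false then (1 : ℝ) else 0) ∂P)
          / (∫ ω, ψ ω * (if D0 ω = false then (1 : ℝ) else 0) ∂P) := by
  intro π_n π_c ψ
  set c : Ω → ℝ := fun ω => if D0 ω = false ∧ D1 ω = true then (1 : ℝ) else 0 with hc_def
  set n : Ω → ℝ := fun ω => if D1 ω = false then (1 : ℝ) else 0 with hn_def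
  set a : Ω → ℝ := fun ω => if D0 ω = false then (1 : ℝ) else 0 with ha_def
  set H := MeasurableSpace.comap X m𝒳 ⊔ MeasurableSpace.comap D0 inferInstance
  set K := H ⊔ MeasurableSpace.comap D1 inferInstance
  have hH : H ≤ mΩ := sup_le hX.comap_le hD0.comap_le
  have hK : K ≤ mΩ := sup_le hH hD1.comap_le
  have hD0H : Measurable[H] D0 := (comap_measurable D0).mono le_sup_right le_rfl
  have hD0K : Measurable[K] D0 := hD0H.mono le_sup_left le_rfl
  have hD1K : Measurable[K] D1 := (comap_measurable D1).mono le_sup_right le_rfl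
  have hCK : MeasurableSet[K] {ω | D0 ω = false ∧ D1 ω = true} :=
    (hD0K (measurableSet_singleton false)).inter (hD1K (measurableSet_singleton true))
  have hC : MeasurableSet[mΩ] {ω | D0 ω = false ∧ D1 ω = true} := hK _ hCK
  have hcK : StronglyMeasurable[K] c :=
    (Measurable.ite hCK measurable_const measurable_const).stronglyMeasurable
  have haH : StronglyMeasurable[H] a :=
    (Measurable.ite (hD0H (measurableSet_singleton false))
      measurable_const measurable_const).stronglyMeasurable
  have hnm : Measurable[mΩ] n :=
    Measurable.ite (hD1 (measurableSet_singleton false)) measurable_const measurable_const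
  have hc0 : 0 ≤ c := fun ω => by simp only [hc_def, Pi.zero_apply]; split_ifs <;> norm_num
  have hn0 : 0 ≤ n := fun ω => by simp only [hn_def, Pi.zero_apply]; split_ifs <;> norm_num
  have hc1 : ∀ ω, ‖c ω‖ ≤ 1 := fun ω => by simp only [hc_def]; split_ifs <;> norm_num
  have hn1 : ∀ ω, ‖n ω‖ ≤ 1 := fun ω => by simp only [hn_def]; split_ifs <;> norm_num
  have ha1 : ∀ ω, ‖a ω‖ ≤ 1 := fun ω => by simp only [ha_def]; split_ifs <;> norm_num
  have hcm : AEStronglyMeasurable[mΩ] c P := (hcK.mono hK).aestronglyMeasurable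
  have hci : Integrable c P := .of_bound hcm 1 (.of_forall hc1)
  have hni : Integrable n P := .of_bound hnm.aestronglyMeasurable 1 (.of_forall hn1)
  have hadd : ∀ ω, c ω + n ω = if D0 ω = false then 1 else 0 := fun ω => by
    have := hmono ω
    simp only [hc_def, hn_def]
    cases h0 : D0 ω <;> cases h1 : D1 ω <;> simp_all
  have hscore : (fun ω => ψ ω * a ω) =ᵐ[P] P[c|H] :=
    condExp_sup_comap_eq_condExp_div_add hX hD0 false hc0 hn0 hci hni hadd
  have hψm : StronglyMeasurable[MeasurableSpace.comap X m𝒳] ψ :=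
    (stronglyMeasurable_condExp.measurable.div (stronglyMeasurable_condExp.measurable.add
      stronglyMeasurable_condExp.measurable)).stronglyMeasurable
  have hψH : StronglyMeasurable[H] ψ := hψm.mono le_sup_left
  have hψaH : StronglyMeasurable[H] fun ω => ψ ω * a ω :=
    hψH.mul haH
  have hψa1 : ∀ᵐ ω ∂P, ‖ψ ω * a ω‖ ≤ 1 := by
    filter_upwards [condExp_div_add_mem_Icc (m := MeasurableSpace.comap X m𝒳) hc0 hn0] with ω h
    rw [norm_mul]
    refine mul_le_one₀ ?_ (norm_nonneg _) (ha1 ω)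
    rw [Real.norm_eq_abs, abs_of_nonneg h.1]
    exact h.2
  have hmean : ∫ ω, ψ ω * Y0 ω * a ω ∂P = ∫ ω, Y0 ω * c ω ∂P :=
    calc ∫ ω, ψ ω * Y0 ω * a ω ∂P
      _ = ∫ ω, ψ ω * a ω * Y0 ω ∂P := by simp_rw [mul_right_comm]
      _ = ∫ ω, ψ ω * a ω * (P[Y0|H]) ω ∂P :=
        (integral_mul_condExp_of_stronglyMeasurable_left hH hψaH
          (hY0.bdd_mul (hψaH.mono hH).aestronglyMeasurable hψa1) hY0).symm
      _ = ∫ ω, (P[Y0|H]) ω * (P[c|H]) ω ∂P := by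
        refine integral_congr_ae ?_
        filter_upwards [hscore] with ω h
        rw [h, mul_comm]
      _ = ∫ ω, (P[Y0|H]) ω * c ω ∂P :=
        integral_mul_condExp_of_stronglyMeasurable_left hH stronglyMeasurable_condExp
          (integrable_condExp.mul_bdd hcm (.of_forall hc1)) hci
      _ = ∫ ω, c ω * (P[Y0|K]) ω ∂P := by
        refine integral_congr_ae ?_
        filter_upwards [hWPI] with ω h
        by_cases h0 : D0 ω = false
        · rw [h h0, mul_comm]
        · simp [hc_def, h0]
      _ = ∫ ω, c ω * Y0 ω ∂P :=
        integral_mul_condExp_of_stronglyMeasurable_left hK hcK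
          (hY0.bdd_mul hcm (.of_forall hc1)) hY0
      _ = ∫ ω, Y0 ω * c ω ∂P := by simp_rw [mul_comm]
  have hc_ind : c = {ω | D0 ω = false ∧ D1 ω = true}.indicator 1 := by
    ext ω
    by_cases h : D0 ω = false ∧ D1 ω = true
    · exact (if_pos h).trans (Set.indicator_of_mem h 1).symm
    · exact (if_neg h).trans (Set.indicator_of_notMem h 1).symm
  have hprob : ∫ ω, ψ ω * a ω ∂P = (P {ω | D0 ω = false ∧ D1 ω = true}).toReal := by
    rw [integral_congr_ae hscore, integral_condExp hH, hc_ind]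
    exact integral_indicator_one hC
  refine ⟨hmean, hprob, ?_⟩
  have hY0c : ∫ ω, Y0 ω * c ω ∂P = ∫ ω in {ω | D0 ω = false ∧ D1 ω = true}, Y0 ω ∂P := by
    rw [← integral_indicator hC, hc_ind]
    simp_rw [← Set.indicator_mul_right, Pi.one_apply, mul_one]
  rw [hmean, hprob, hY0c, ← Set.ofPred_and, ProbabilityTheory.cond, integral_smul_measure,
    ENNReal.toReal_inv, smul_eq_mul, div_eq_inv_mul]
end

section
/- Identification of the Always-Taker effect under Weak Principal Ignorability: assume randomization (Z independent of (X, D0, D1, Y0, Y1) with 0 < P(Z = true) < 1), monotonicity (D0 ≤ D1 pointwise), P(D0 = true) > 0, and the weak ignorability condition that E[Y1 | σ(X) ⊔ σ(D0) ⊔ σ(D1)] = E[Y1 | σ(X) ⊔ σ(D1)] holds P-almost surely on {D1 = true}. Define π_a := E[1_{D0 = true} | σ(X)], π_c := E[1_{D0 = false, D1 = true} | σ(X)], and φ := π_c / (π_c + π_a) (arbitrary where the denominator vanishes). Then, with D := if Z then D1 else D0 and Y := if Z then Y1 else Y0, E[Y1 | D0 = true] = E[(1 − φ) · Y1 · 1_{D1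 = true}] / P(D0 = true) and E[Y0 | D0 = true] = E[Y | {Z = false} ∩ {D = true}]; hence E[Y1 − Y0 | D0 = true] = E[(1 − φ) · Y1 · 1_{D1 = true}] / P(D0 = true) − E[Y | {Z = false} ∩ {D = true}]. -/
open MeasureTheory ProbabilityTheory

/-- The trace on `{D = true}` of the σ-algebra `m ⊔ σ(D)` agrees with the trace of `m`. -/
lemma exists_inter_eq_of_measurableSet_sup_comap {Ω : Type*} {m : MeasurableSpace Ω}
    {D : Ω → Bool} {s : Set Ω}
    (hs : MeasurableSet[m ⊔ MeasurableSpace.comap D inferInstance] s) :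
    ∃ b, MeasurableSet[m] b ∧ s ∩ {ω | D ω = true} = b ∩ {ω | D ω = true} := by
  have hle : m ⊔ MeasurableSpace.comap D inferInstance ≤
      MeasurableSpace.map ((↑) : {ω | D ω = true} → Ω)
        (MeasurableSpace.comap ((↑) : {ω | D ω = true} → Ω) m) := by
    refine sup_le (fun t ht => ⟨t, ht, rfl⟩) ?_
    rintro _ ⟨u, -, rfl⟩
    by_cases hu : true ∈ u
    · refine ⟨Set.univ, MeasurableSet.univ, ?_⟩
      ext ⟨ω, hω : D ω = true⟩
      simp [hω, hu]
    · refine ⟨∅, MeasurableSet.empty, ?_⟩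
      ext ⟨ω, hω : D ω = true⟩
      simp [hω, hu]
  obtain ⟨b, hb, hbs⟩ := hle s hs
  refine ⟨b, hb, ?_⟩
  ext ω
  simp only [Set.mem_inter_iff, and_congr_left_iff]
  intro hω
  exact (Set.ext_iff.1 hbs ⟨ω, hω⟩).symm

lemma integral_cond_eq_div {Ω : Type*} {mΩ : MeasurableSpace Ω} (P : Measure Ω)
    (s : Set Ω) (f : Ω → ℝ) :
    ∫ ω, f ω ∂(P[|s]) = (∫ ω in s, f ω ∂P) / (P s).toReal := by
  rw [ProbabilityTheory.cond, integral_smul_measure, ENNReal.toReal_inv, smul_eq_mul,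
    inv_mul_eq_div]

lemma integrable_cond {Ω : Type*} {mΩ : MeasurableSpace Ω} {P : Measure Ω}
    {s : Set Ω} {f : Ω → ℝ} (hf : Integrable f P) (hs : P s ≠ 0) :
    Integrable f (P[|s]) :=
  hf.restrict.smul_measure (ENNReal.inv_ne_top.2 hs)

lemma integral_condExp_mul_eq {Ω : Type*} {m mΩ : MeasurableSpace Ω} {P : Measure Ω}
    [IsFiniteMeasure P] (hm : m ≤ mΩ) {f g : Ω → ℝ} (hf : StronglyMeasurable[m] f)
    (hg : Integrable g P) (hfg : Integrable (fun ω => f ω * g ω) P) :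
    ∫ ω, f ω * (P[g|m]) ω ∂P = ∫ ω, f ω * g ω ∂P := by
  rw [← integral_condExp hm (f := fun ω => f ω * g ω)]
  exact integral_congr_ae (condExp_mul_of_stronglyMeasurable_left hf hfg hg).symm

section PrincipalScore

variable {Ω : Type*} {m mΩ : MeasurableSpace Ω} {P : Measure Ω} {D0 D1 : Ω → Bool}

/-- The share of Compliers among the treated units, given the σ-algebra `m`. -/
noncomputable def complierShare (P : Measure Ω) (m : MeasurableSpace Ω) (D0 D1 : Ω → Bool) :
    Ω → ℝ := fun ω =>
  (P[(fun ω => if D0 ω = false ∧ D1 ω = true then (1 : ℝ) else 0) | m]) ω /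
    ((P[(fun ω => if D0 ω = false ∧ D1 ω = true then (1 : ℝ) else 0) | m]) ω +
      (P[(fun ω => if D0 ω then (1 : ℝ) else 0) | m]) ω)

lemma stronglyMeasurable_complierShare :
    StronglyMeasurable[m] (complierShare P m D0 D1) := by
  have h1 := (stronglyMeasurable_condExp (μ := P) (m := m)
    (f := fun ω => if D0 ω = false ∧ D1 ω = true then (1 : ℝ) else 0)).measurable
  have h2 := (stronglyMeasurable_condExp (μ := P) (m := m)
    (f := fun ω => if D0 ω then (1 : ℝ) else 0)).measurable
  exact (h1.div (h1.add h2)).stronglyMeasurable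

lemma complierShare_mem_Icc : ∀ᵐ ω ∂P, complierShare P m D0 D1 ω ∈ Set.Icc (0 : ℝ) 1 := by
  have h1 : 0 ≤ᵐ[P] P[(fun ω => if D0 ω = false ∧ D1 ω = true then (1 : ℝ) else 0) | m] :=
    condExp_nonneg (.of_forall fun ω => by dsimp only [Pi.zero_apply]; positivity)
  have h2 : 0 ≤ᵐ[P] P[(fun ω => if D0 ω then (1 : ℝ) else 0) | m] :=
    condExp_nonneg (.of_forall fun ω => by dsimp only [Pi.zero_apply]; positivity)
  filter_upwards [h1, h2] with ω h1 h2
  simp only [Pi.zero_apply] at h1 h2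
  exact ⟨div_nonneg h1 (add_nonneg h1 h2), div_le_one_of_le₀ (by linarith) (add_nonneg h1 h2)⟩

lemma integrable_ite_eq_true [IsFiniteMeasure P] (hD : Measurable D0) :
    Integrable (fun ω => if D0 ω then (1 : ℝ) else 0) P :=
  (integrable_const (1 : ℝ)).mono'
    (Measurable.ite (hD (measurableSet_singleton true)) measurable_const
      measurable_const).aestronglyMeasurable
    (.of_forall fun ω => by split_ifs <;> simp)

lemma integrable_ite_complier [IsFiniteMeasure P] (hD0 : Measurable D0) (hD1 : Measurable D1) :
    Integrable (fun ω => if D0 ω = false ∧ D1 ω = true then (1 : ℝ) else 0) P :=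
  (integrable_const (1 : ℝ)).mono'
    (Measurable.ite ((hD0 (measurableSet_singleton false)).inter
      (hD1 (measurableSet_singleton true))) measurable_const
      measurable_const).aestronglyMeasurable
    (.of_forall fun ω => by split_ifs <;> simp)

/-- `(1 - φ) E[1_{D1} | m] = E[1_{D0} | m]` under monotonicity. -/
lemma one_sub_complierShare_mul_condExp [IsFiniteMeasure P] (hD0 : Measurable D0) (hD1 : Measurable D1)
    (hmono : ∀ ω, D0 ω = true → D1 ω = true) :
    ∀ᵐ ω ∂P, (1 - complierShare P m D0 D1 ω) *
        (P[(fun ω => if D1 ω then (1 : ℝ) else 0) | m]) ω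
      = (P[(fun ω => if D0 ω then (1 : ℝ) else 0) | m]) ω := by
  have h1 : 0 ≤ᵐ[P] P[(fun ω => if D0 ω = false ∧ D1 ω = true then (1 : ℝ) else 0) | m] :=
    condExp_nonneg (.of_forall fun ω => by dsimp only [Pi.zero_apply]; positivity)
  have h2 : 0 ≤ᵐ[P] P[(fun ω => if D0 ω then (1 : ℝ) else 0) | m] :=
    condExp_nonneg (.of_forall fun ω => by dsimp only [Pi.zero_apply]; positivity)
  have hsum : (fun ω => if D1 ω then (1 : ℝ) else 0) =
      (fun ω => if D0 ω = false ∧ D1 ω = true then (1 : ℝ) else 0) +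
        fun ω => if D0 ω then (1 : ℝ) else 0 := by
    ext ω
    have := hmono ω
    cases h0 : D0 ω <;> cases h1 : D1 ω <;> simp_all
  have h3 := condExp_add (μ := P) (integrable_ite_complier hD0 hD1)
    (integrable_ite_eq_true hD0) m
  rw [← hsum] at h3
  filter_upwards [h1, h2, h3] with ω h1 h2 h3
  rw [h3]
  simp only [Pi.zero_apply, Pi.add_apply, complierShare] at h1 h2 ⊢
  generalize (P[(fun ω => if D0 ω = false ∧ D1 ω = true then (1 : ℝ) else 0) | m]) ω = c at *
  generalize (P[(fun ω => if D0 ω then (1 : ℝ) else 0) | m]) ω = a at *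
  by_cases h : c + a = 0
  · rw [h, mul_zero]
    linarith
  · field_simp
    ring

/-- The Always-Taker probability given `m` and `D1` is `(1 - φ) 1_{D1}`. -/
lemma condExp_alwaysTaker_eq [IsFiniteMeasure P] (hm : m ≤ mΩ) (hD0 : Measurable D0) (hD1 : Measurable D1)
    (hmono : ∀ ω, D0 ω = true → D1 ω = true) :
    (fun ω => (1 - complierShare P m D0 D1 ω) * (if D1 ω then (1 : ℝ) else 0)) =ᵐ[P]
      P[(fun ω => if D0 ω then (1 : ℝ) else 0) |
        m ⊔ MeasurableSpace.comap D1 inferInstance] := by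
  have hφ : StronglyMeasurable[m] fun ω => 1 - complierShare P m D0 D1 ω :=
    stronglyMeasurable_const.sub stronglyMeasurable_complierShare
  have hint : Integrable
      (fun ω => (1 - complierShare P m D0 D1 ω) * (if D1 ω then (1 : ℝ) else 0)) P := by
    refine (integrable_ite_eq_true hD1).bdd_mul (c := 1) (hφ.mono hm).aestronglyMeasurable ?_
    filter_upwards [complierShare_mem_Icc (P := P) (m := m) (D0 := D0) (D1 := D1)] with ω hω
    rw [Real.norm_eq_abs, abs_le]
    constructor <;> linarith [hω.1, hω.2]
  have hsup : m ⊔ MeasurableSpace.comap D1 inferInstance ≤ mΩ := sup_le hm hD1.comap_le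
  have hT : MeasurableSet[m ⊔ MeasurableSpace.comap D1 inferInstance] {ω | D1 ω = true} :=
    (le_sup_right : MeasurableSpace.comap D1 inferInstance ≤ _) _
      ⟨{true}, measurableSet_singleton true, rfl⟩
  refine ae_eq_condExp_of_forall_setIntegral_eq hsup (integrable_ite_eq_true hD0)
    (fun s _ _ => hint.integrableOn) ?_ ?_
  · intro s hs _
    obtain ⟨b, hb, hbs⟩ := exists_inter_eq_of_measurableSet_sup_comap hs
    have hind : ∀ f : Ω → ℝ, (∀ ω, D1 ω = false → f ω = 0) →
        ∫ ω in s, f ω ∂P = ∫ ω in b, f ω ∂P := by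
      intro f hf
      rw [← integral_indicator (hsup s hs), ← integral_indicator (hm b hb)]
      refine integral_congr_ae (.of_forall fun ω => ?_)
      cases h : D1 ω
      · by_cases h1 : ω ∈ s <;> by_cases h2 : ω ∈ b <;> simp [h1, h2, hf ω h]
      · have hiff : ω ∈ s ↔ ω ∈ b := by simpa [h] using Set.ext_iff.1 hbs ω
        by_cases hω : ω ∈ b
        · simp [hω, hiff.2 hω]
        · simp [hω, mt hiff.1 hω]
    rw [hind _ fun ω h => by simp [h], hind _ fun ω h => ?_]
    · have hbφ : StronglyMeasurable[m] (b.indicator fun ω => 1 - complierShare P m D0 D1 ω) :=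
        hφ.indicator hb
      have hmul : ∀ g : Ω → ℝ, ∫ ω in b, (1 - complierShare P m D0 D1 ω) * g ω ∂P =
          ∫ ω, b.indicator (fun ω => 1 - complierShare P m D0 D1 ω) ω * g ω ∂P := by
        intro g
        rw [← integral_indicator (hm b hb)]
        congr 1
        ext ω
        by_cases h : ω ∈ b <;> simp [h]
      rw [hmul, ← integral_condExp_mul_eq hm hbφ (integrable_ite_eq_true hD1), ← hmul,
        ← setIntegral_condExp hm (integrable_ite_eq_true hD0) hb]
      · exact integral_congr_ae
          (ae_restrict_of_ae (one_sub_complierShare_mul_condExp hD0 hD1 hmono))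
      · refine (hint.indicator (hm b hb)).congr (.of_forall fun ω => ?_)
        by_cases h : ω ∈ b <;> simp [h]
    · have := hmono ω
      cases h0 : D0 ω <;> simp_all
  · refine StronglyMeasurable.aestronglyMeasurable (StronglyMeasurable.mul
      (f := fun ω => 1 - complierShare P m D0 D1 ω)
      (g := fun ω => if D1 ω then (1 : ℝ) else 0) (hφ.mono le_sup_left) ?_)
    exact (Measurable.ite hT measurable_const measurable_const).stronglyMeasurable

end PrincipalScore

/-- Under Weak Principal Ignorability, `E[Y1 1_{D0}] = E[(1 - φ) Y1 1_{D1}]`. -/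
lemma setIntegral_alwaysTaker_eq {Ω : Type*} {m mΩ : MeasurableSpace Ω} {P : Measure Ω}
    [IsFiniteMeasure P] {D0 D1 : Ω → Bool} {Y1 : Ω → ℝ} (hm : m ≤ mΩ)
    (hD0 : Measurable D0) (hD1 : Measurable D1) (hY1 : Integrable Y1 P)
    (hmono : ∀ ω, D0 ω = true → D1 ω = true)
    (hWPI : ∀ᵐ ω ∂P, D1 ω = true →
      (P[Y1 | m ⊔ MeasurableSpace.comap D0 inferInstance
            ⊔ MeasurableSpace.comap D1 inferInstance]) ω
        = (P[Y1 | m ⊔ MeasurableSpace.comap D1 inferInstance]) ω) :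
    ∫ ω in {ω | D0 ω = true}, Y1 ω ∂P =
      ∫ ω, (1 - complierShare P m D0 D1 ω) * Y1 ω * (if D1 ω then (1 : ℝ) else 0) ∂P := by
  have hm3 : m ⊔ MeasurableSpace.comap D0 inferInstance
      ⊔ MeasurableSpace.comap D1 inferInstance ≤ mΩ :=
    sup_le (sup_le hm hD0.comap_le) hD1.comap_le
  have hm2 : m ⊔ MeasurableSpace.comap D1 inferInstance ≤ mΩ := sup_le hm hD1.comap_le
  have hA : MeasurableSet[m ⊔ MeasurableSpace.comap D0 inferInstance
      ⊔ MeasurableSpace.comap D1 inferInstance] {ω | D0 ω = true} :=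
    (le_sup_right.trans le_sup_left : MeasurableSpace.comap D0 inferInstance ≤ _) _
      ⟨{true}, measurableSet_singleton true, rfl⟩
  set g := P[Y1 | m ⊔ MeasurableSpace.comap D1 inferInstance]
  set a : Ω → ℝ := fun ω => if D0 ω then (1 : ℝ) else 0 with ha
  have hga : Integrable (fun ω => g ω * a ω) P := by
    have hgint : Integrable g P := integrable_condExp
    refine (hgint.indicator (hm3 _ hA)).congr (.of_forall fun ω => ?_)
    cases h : D0 ω <;> simp [ha, h]
  have hT := condExp_alwaysTaker_eq (P := P) hm hD0 hD1 hmono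
  set w := P[a | m ⊔ MeasurableSpace.comap D1 inferInstance]
  have hwY : Integrable (fun ω => w ω * Y1 ω) P := by
    refine hY1.bdd_mul (c := 1) integrable_condExp.aestronglyMeasurable ?_
    filter_upwards [hT, complierShare_mem_Icc (P := P) (m := m) (D0 := D0) (D1 := D1)]
      with ω h hω
    rw [← h, Real.norm_eq_abs, abs_le]
    split_ifs <;> constructor <;> linarith [hω.1, hω.2]
  calc ∫ ω in {ω | D0 ω = true}, Y1 ω ∂P
      = ∫ ω in {ω | D0 ω = true}, g ω ∂P := by
        rw [← setIntegral_condExp hm3 hY1 hA]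
        refine setIntegral_congr_ae (hm3 _ hA) ?_
        filter_upwards [hWPI] with ω h h0
        exact h (hmono ω h0)
    _ = ∫ ω, g ω * a ω ∂P := by
        rw [← integral_indicator (hm3 _ hA)]
        congr 1
        ext ω
        cases h : D0 ω <;> simp [ha, h]
    _ = ∫ ω, g ω * w ω ∂P :=
        (integral_condExp_mul_eq hm2 stronglyMeasurable_condExp (integrable_ite_eq_true hD0)
          hga).symm
    _ = ∫ ω, w ω * g ω ∂P := by simp only [mul_comm]
    _ = ∫ ω, w ω * Y1 ω ∂P :=
        integral_condExp_mul_eq hm2 stronglyMeasurable_condExp hY1 hwY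
    _ = _ := by
        refine integral_congr_ae ?_
        filter_upwards [hT] with ω h
        rw [← h]
        ring

/-- Conditioning on an independent event does not change a conditional expectation. -/
lemma integral_cond_inter_of_indepFun {Ω α : Type*} {mΩ : MeasurableSpace Ω}
    {mα : MeasurableSpace α} {P : Measure Ω} [IsProbabilityMeasure P]
    {Z : Ω → Bool} {W : Ω → α} (hZ : Measurable Z) (hW : Measurable W)
    (hindep : IndepFun Z W P) {f : α → ℝ} (hf : Measurable f) {s : Set α}
    (hs : MeasurableSet s) {u : Set Bool} (hu : P (Z ⁻¹' u) ≠ 0) :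
    ∫ ω, f (W ω) ∂(P[|Z ⁻¹' u ∩ W ⁻¹' s]) = ∫ ω, f (W ω) ∂(P[|W ⁻¹' s]) := by
  have hum : MeasurableSet u := .of_discrete
  rw [integral_cond_eq_div, integral_cond_eq_div,
    hindep.measure_inter_preimage_eq_mul u s hum hs, ENNReal.toReal_mul]
  have h1 : Measurable (u.indicator fun _ => (1 : ℝ)) := measurable_const.indicator hum
  have h2 : Measurable (s.indicator f) := hf.indicator hs
  have key := (hindep.comp h1 h2).integral_fun_mul_eq_mul_integral
    (h1.comp hZ).aestronglyMeasurable (h2.comp hW).aestronglyMeasurable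
  have e1 : ∫ ω in Z ⁻¹' u ∩ W ⁻¹' s, f (W ω) ∂P =
      ∫ ω, ((u.indicator fun _ => (1 : ℝ)) ∘ Z) ω * (s.indicator f ∘ W) ω ∂P := by
    rw [← integral_indicator ((hZ hum).inter (hW hs))]
    congr 1
    ext ω
    by_cases hz : Z ω ∈ u <;> by_cases hw : W ω ∈ s <;> simp [hz, hw]
  have e2 : ∫ ω, ((u.indicator fun _ => (1 : ℝ)) ∘ Z) ω ∂P = (P (Z ⁻¹' u)).toReal := by
    exact integral_indicator_one (hZ hum)
  have e3 : ∫ ω, (s.indicator f ∘ W) ω ∂P = ∫ ω in W ⁻¹' s, f (W ω) ∂P := by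
    rw [← integral_indicator (hW hs)]
    rfl
  rw [e1, key, e2, e3]
  exact mul_div_mul_left _ _ (ENNReal.toReal_ne_zero.2 ⟨hu, measure_ne_top _ _⟩)

/-- Identification of the Always-Taker effect under Weak Principal Ignorability:
`E[Y1 | D0 = true] = E[(1 − φ)·Y1·1_{D1}] / P(D0 = true)`,
`E[Y0 | D0 = true] = E[Y | Z = false, D = true]`, and hence
`E[Y1 − Y0 | D0 = true]
  = E[(1 − φ)·Y1·1_{D1}] / P(D0 = true) − E[Y | Z = false, D = true]`. -/
theorem always_taker_effect_weak_PI
    {Ω 𝒳 : Type*} {mΩ : MeasurableSpace Ω} {m𝒳 : MeasurableSpace 𝒳}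
    (P : Measure Ω) [IsProbabilityMeasure P]
    (X : Ω → 𝒳) (D0 D1 Z : Ω → Bool) (Y0 Y1 : Ω → ℝ)
    (hX : Measurable X) (hD0 : Measurable D0) (hD1 : Measurable D1)
    (hZ : Measurable Z) (hY0m : Measurable Y0) (hY1m : Measurable Y1)
    (hY0 : Integrable Y0 P) (hY1 : Integrable Y1 P)
    (hindep : IndepFun Z (fun ω => (X ω, D0 ω, D1 ω, Y0 ω, Y1 ω)) P)
    (hZpos : 0 < P {ω | Z ω = true}) (hZlt : P {ω | Z ω = true} < 1)
    (hmono : ∀ ω, D0 ω = true → D1 ω = true)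
    (hapos : 0 < P {ω | D0 ω = true})
    (hWPI : ∀ᵐ ω ∂P, D1 ω = true →
      (P[Y1 | MeasurableSpace.comap X m𝒳 ⊔ MeasurableSpace.comap D0 inferInstance
            ⊔ MeasurableSpace.comap D1 inferInstance]) ω
        = (P[Y1 | MeasurableSpace.comap X m𝒳 ⊔ MeasurableSpace.comap D1 inferInstance]) ω) :
    let π_a := P[(fun ω => if D0 ω then (1 : ℝ) else 0) | MeasurableSpace.comap X m𝒳]
    let π_c := P[(fun ω => if D0 ω = false ∧ D1 ω = true then (1 : ℝ) else 0) |
        MeasurableSpace.comap X m𝒳]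
    let φ := fun ω => π_c ω / (π_c ω + π_a ω)
    (∫ ω, Y1 ω ∂(P[|{ω | D0 ω = true}]))
        = (∫ ω, (1 - φ ω) * Y1 ω * (if D1 ω then (1 : ℝ) else 0) ∂P)
          / (P {ω | D0 ω = true}).toReal
      ∧ (∫ ω, Y0 ω ∂(P[|{ω | D0 ω = true}]))
        = ∫ ω, (if Z ω then Y1 ω else Y0 ω)
            ∂(P[|{ω | Z ω = false} ∩ {ω | (if Z ω then D1 ω else D0 ω) = true}])
      ∧ (∫ ω, (Y1 ω - Y0 ω) ∂(P[|{ω | D0 ω = true}]))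
        = (∫ ω, (1 - φ ω) * Y1 ω * (if D1 ω then (1 : ℝ) else 0) ∂P)
            / (P {ω | D0 ω = true}).toReal
          - ∫ ω, (if Z ω then Y1 ω else Y0 ω)
              ∂(P[|{ω | Z ω = false} ∩ {ω | (if Z ω then D1 ω else D0 ω) = true}]) := by
  intro π_a π_c φ
  have hA : MeasurableSet {ω | D0 ω = true} := hD0 (measurableSet_singleton true)
  have h1 : ∫ ω, Y1 ω ∂(P[|{ω | D0 ω = true}])
      = (∫ ω, (1 - φ ω) * Y1 ω * (if D1 ω then (1 : ℝ) else 0) ∂P)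
        / (P {ω | D0 ω = true}).toReal := by
    rw [integral_cond_eq_div,
      setIntegral_alwaysTaker_eq hX.comap_le hD0 hD1 hY1 hmono hWPI]
    rfl
  have hset : {ω | Z ω = false} ∩ {ω | (if Z ω then D1 ω else D0 ω) = true}
      = {ω | Z ω = false} ∩ {ω | D0 ω = true} := by
    ext ω
    cases h : Z ω <;> simp [h]
  have hZfalse : P {ω | Z ω = false} ≠ 0 := by
    have hcompl : {ω | Z ω = false} = {ω | Z ω = true}ᶜ := by
      ext ω
      simp
    rw [hcompl, prob_compl_eq_one_sub (show MeasurableSet {ω | Z ω = true} from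
      hZ (measurableSet_singleton true))]
    exact (tsub_pos_of_lt hZlt).ne'
  have h2 : ∫ ω, Y0 ω ∂(P[|{ω | D0 ω = true}])
      = ∫ ω, (if Z ω then Y1 ω else Y0 ω)
          ∂(P[|{ω | Z ω = false} ∩ {ω | (if Z ω then D1 ω else D0 ω) = true}]) := by
    rw [hset]
    have hcongr : ∫ ω, (if Z ω then Y1 ω else Y0 ω)
          ∂(P[|{ω | Z ω = false} ∩ {ω | D0 ω = true}])
        = ∫ ω, Y0 ω ∂(P[|{ω | Z ω = false} ∩ {ω | D0 ω = true}]) := by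
      rw [integral_cond_eq_div, integral_cond_eq_div]
      congr 1
      refine setIntegral_congr_fun ((hZ (measurableSet_singleton false)).inter hA) ?_
      rintro ω ⟨hω, -⟩
      simp_all
    rw [hcongr]
    exact (integral_cond_inter_of_indepFun (u := {false})
      (s := {p : 𝒳 × Bool × Bool × ℝ × ℝ | p.2.1 = true}) (f := fun p => p.2.2.2.1)
      hZ (hX.prodMk (hD0.prodMk (hD1.prodMk (hY0m.prodMk hY1m)))) hindep (by fun_prop)
      ((measurable_fst.comp measurable_snd) (measurableSet_singleton true)) hZfalse).symm
  refine ⟨h1, h2, ?_⟩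
  rw [integral_sub (integrable_cond hY1 hapos.ne') (integrable_cond hY0 hapos.ne'), h1, h2]
end
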